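/- arXiv:2011.12262 — 3 statements merged into one kernel-verified Lean document; each statement's English description precedes it below -/
import Mathlib

section
/- Let M₁ and M₂ be STRIPS models over the same facts F and actions A such that M₁ is at least as constrained as M₂. If a plan π is executable in M₁ from a state s₁, and s₁ ⊆ s₂, then π is also executable in M₂ from s₂, and the final state reached by π in M₁ from s₁ is a subset of the final state reached by π in M₂ from s₂. -/
/-- A STRIPS model over facts `F` and actions `A`. -/
structure Strips (F A : Type*) where
  pre : A → Set F
  add : A → Set F
  del : A → Set F

namespace Strips

variable {F A : Type*}

/-- Result of applying action `a` in state `s`. -/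
def apply (M : Strips F A) (s : Set F) (a : A) : Set F :=
  (s ∪ M.add a) \ M.del a

/-- A plan is executable from a state if each action is applicable
(its precondition holds) at the state where it is applied. -/
def Exec (M : Strips F A) : Set F → List A → Prop
  | _, [] => True
  | s, a :: π => M.pre a ⊆ s ∧ M.Exec (M.apply s a) π

/-- The final state reached by applying a plan from a state. -/
def final (M : Strips F A) : Set F → List A → Set F
  | s, [] => s
  | s, a :: π => M.final (M.apply s a) π

/-- A plan is valid for problem `(I, G)` if it is executable from `I`
and the final state contains `G`. -/
def Valid (M : Strips F A) (I G : Set F) (π : List A) : Prop :=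
  M.Exec I π ∧ G ⊆ M.final I π

/-- `M₁` is at least as constrained as `M₂`. -/
def MoreConstrained (M₁ M₂ : Strips F A) : Prop :=
  ∀ a, M₂.pre a ⊆ M₁.pre a ∧ M₁.add a ⊆ M₂.add a ∧ M₂.del a ⊆ M₁.del a

/-- The cost of a plan: the sum of action costs, with multiplicity. -/
def planCost (c : A → ℝ) (π : List A) : ℝ := (π.map c).sum

/-- The optimal cost of problem `(I, G)` in model `M`:
the infimum of the costs of its valid plans. -/
noncomputable def optCost (M : Strips F A) (c : A → ℝ) (I G : Set F) : ℝ :=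
  sInf (planCost c '' {π | M.Valid I G π})

end Strips

theorem Strips.MoreConstrained.apply_subset_apply {F A : Type*} {M₁ M₂ : Strips F A}
    (h : M₁.MoreConstrained M₂) {s₁ s₂ : Set F} (hs : s₁ ⊆ s₂) (a : A) :
    M₁.apply s₁ a ⊆ M₂.apply s₂ a :=
  Set.sdiff_subset_sdiff (Set.union_subset_union hs (h a).2.1) (h a).2.2

theorem exec_mono_of_moreConstrained {F A : Type*}
    (M₁ M₂ : Strips F A) (h : M₁.MoreConstrained M₂)
    (π : List A) (s₁ s₂ : Set F) (hs : s₁ ⊆ s₂)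
    (hexec : M₁.Exec s₁ π) :
    M₂.Exec s₂ π ∧ M₁.final s₁ π ⊆ M₂.final s₂ π := by
  induction π generalizing s₁ s₂ with
  | nil => exact ⟨trivial, hs⟩
  | cons a π ih =>
    obtain ⟨hpre, hrest⟩ := hexec
    obtain ⟨hexec₂, hfinal⟩ := ih _ _ (h.apply_subset_apply hs a) hrest
    exact ⟨⟨(h a).1.trans (hpre.trans hs), hexec₂⟩, hfinal⟩
end

section
/- Let M₁ and M₂ be STRIPS models over the same facts F and actions A such that M₁ is at least as constrained as M₂. Then for every initial state I : Set F and goal G : Set F, every plan valid for the problem (I, G) in M₁ is also valid for (I, G) in M₂; that is, the set of valid plans of the constrained model is contained in the set of valid plans of the relaxed model. -/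
namespace Strips

variable {F A : Type*} {M₁ M₂ : Strips F A}

theorem MoreConstrained.apply_subset_apply_s1 (h : M₁.MoreConstrained M₂) {s t : Set F}
    (hst : s ⊆ t) (a : A) : M₁.apply s a ⊆ M₂.apply t a :=
  Set.sdiff_subset_sdiff (Set.union_subset_union hst (h a).2.1) (h a).2.2

theorem MoreConstrained.exec_and_final_subset (h : M₁.MoreConstrained M₂) {s t : Set F}
    (hst : s ⊆ t) {π : List A} (hπ : M₁.Exec s π) :
    M₂.Exec t π ∧ M₁.final s π ⊆ M₂.final t π := by
  induction π generalizing s t with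
  | nil => exact ⟨trivial, hst⟩
  | cons a π ih =>
    obtain ⟨hexec, hfinal⟩ := ih (h.apply_subset_apply_s1 hst a) hπ.2
    exact ⟨⟨((h a).1.trans hπ.1).trans hst, hexec⟩, hfinal⟩

end Strips

theorem valid_subset_of_moreConstrained {F A : Type*}
    (M₁ M₂ : Strips F A) (h : M₁.MoreConstrained M₂)
    (I G : Set F) :
    {π : List A | M₁.Valid I G π} ⊆ {π : List A | M₂.Valid I G π} := by
  rintro π ⟨hexec, hgoal⟩
  obtain ⟨hexec', hfinal⟩ := h.exec_and_final_subset subset_rfl hexec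
  exact ⟨hexec', hgoal.trans hfinal⟩
end

section
/- Let M⁻ be a STRIPS model over facts F and actions A, let a, a', a'' be actions, and let p : F be a fact with p ∈ add(a) (the possible add effect is present in M⁻), p ∈ pre(a'), p ∉ pre(a), del(a) ∩ pre(a') = ∅, add(a') ∩ del(a') = ∅, and add(a) ∩ (del(a) ∪ del(a')) = ∅. Define the initial state I = (pre(a) ∪ pre(a') ∪ pre(a'')) \ {p} and the goal G = (add(a) ∪ add(a')) \ {p}. Then the two-action plan ⟨a, a'⟩ is valid for the problem (I, G) in M⁻. -/
theorem template_eff_plan_valid_in_minus {F A : Type*}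
    (Mm : Strips F A) (a a' a'' : A) (p : F)
    (hpadd : p ∈ Mm.add a) (hppre : p ∈ Mm.pre a') (hpa : p ∉ Mm.pre a)
    (hdel1 : Mm.del a ∩ Mm.pre a' = ∅)
    (hdel2 : Mm.add a' ∩ Mm.del a' = ∅)
    (hdel3 : Mm.add a ∩ (Mm.del a ∪ Mm.del a') = ∅) :
    Mm.Valid ((Mm.pre a ∪ Mm.pre a' ∪ Mm.pre a'') \ {p})
      ((Mm.add a ∪ Mm.add a') \ {p}) [a, a'] := by
  have hdel_pre : ∀ x ∈ Mm.pre a', x ∉ Mm.del a := fun x hx hd => hdel1.le ⟨hd, hx⟩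
  have hadd_del' : ∀ x ∈ Mm.add a', x ∉ Mm.del a' := fun x hx hd => hdel2.le ⟨hx, hd⟩
  have hadd_del : ∀ x ∈ Mm.add a, x ∉ Mm.del a ∪ Mm.del a' := fun x hx hd => hdel3.le ⟨hx, hd⟩
  refine ⟨⟨?_, ?_, trivial⟩, ?_⟩
  · intro x hx
    exact ⟨Or.inl (Or.inl hx), fun h => hpa (h ▸ hx)⟩
  · intro x hx
    refine ⟨?_, hdel_pre x hx⟩
    by_cases h : x = p
    · exact Or.inr (h ▸ hpadd)
    · exact Or.inl ⟨Or.inl (Or.inr hx), h⟩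
  · rintro x ⟨hx | hx, -⟩
    · exact ⟨Or.inl ⟨Or.inr hx, fun h => hadd_del x hx (Or.inl h)⟩,
        fun h => hadd_del x hx (Or.inr h)⟩
    · exact ⟨Or.inr hx, hadd_del' x hx⟩
end
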